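/- (Lipschitz estimate for the atomistic stress.) Suppose there are constants M_{r,s} ≥ 0 (r, s ∈ ℛ) such that |∂_r V(g) − ∂_r V(h)| ≤ Σ_{s∈ℛ} M_{r,s} |g_s − h_s| for all g, h ∈ (ℝ²)^ℛ and r ∈ ℛ, and set M^a := Σ_{r,s∈ℛ} |r| |s| M_{r,s}. Then for every y ∈ 𝓨 and every triangle T of 𝒯_ε^per, | Σ_a(y; T) − ∂W(∇y(T)) | ≤ ε M^a osc(∇y; ω_T^a), where ∂W(F) := Σ_{r∈ℛ} ∂_r V(Fℛ) ⊗ r, ∇y(T) is the constant value of ∇y on T, |·| is the Frobenius norm, osc(∇y; ω) := ess sup_{x,x'∈ω} |∇y(x) − ∇y(x')| / ε, and ω_T^a := { x + ε t₁ r₁ + ε t₂ r₂ : x ∈ T, t₁, t₂ ∈ [−1,1], r₁, r₂ ∈ ℛ } is the interaction neighbourhood of T. -/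

import Mathlib

open scoped BigOperators RealInnerProductSpace
open MeasureTheory Filter

noncomputable section

/-- 2×2 real matrices, represented as the finite-dimensional space `Fin 2 → Fin 2 → ℝ`. -/
abbrev Mat2 := Fin 2 → Fin 2 → ℝ

/-- Real vector with coordinates `f`. -/
def toV2 (f : Fin 2 → ℝ) : EuclideanSpace ℝ (Fin 2) :=
  (WithLp.equiv 2 (Fin 2 → ℝ)).symm f

/-- The point `εz ∈ ℝ²` of the scaled lattice `εℤ²`. -/
def latpt (ε : ℝ) (z : Fin 2 → ℤ) : EuclideanSpace ℝ (Fin 2) :=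
  toV2 fun i => ε * (z i : ℝ)

/-- The integer vector `r` as a real vector. -/
def zvec (r : Fin 2 → ℤ) : EuclideanSpace ℝ (Fin 2) :=
  toV2 fun i => (r i : ℝ)

/-- The standard basis vectors `e₁, e₂` of `ℤ²`. -/
def eint (j : Fin 2) : Fin 2 → ℤ := Pi.single j 1

/-- The finite difference operator `D_r v(x) = (v(x+εr) − v(x))/ε`. -/
def fd2 (ε : ℝ) (r : Fin 2 → ℤ) (v : (Fin 2 → ℤ) → EuclideanSpace ℝ (Fin 2))
    (x : Fin 2 → ℤ) : EuclideanSpace ℝ (Fin 2) :=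
  ε⁻¹ • (v (x + r) - v x)

/-- Lower triangle `conv{x, x+εe₁, x+εe₂}` of the cell at `x`. -/
def Tlo (ε : ℝ) (x : Fin 2 → ℤ) : Set (EuclideanSpace ℝ (Fin 2)) :=
  convexHull ℝ {latpt ε x, latpt ε (x + eint 0), latpt ε (x + eint 1)}

/-- Upper triangle `conv{x+εe₁, x+εe₂, x+ε(e₁+e₂)}` of the cell at `x`. -/
def Tup (ε : ℝ) (x : Fin 2 → ℤ) : Set (EuclideanSpace ℝ (Fin 2)) :=
  convexHull ℝ {latpt ε (x + eint 0), latpt ε (x + eint 1), latpt ε (x + eint 0 + eint 1)}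

/-- Gradient of the piecewise affine interpolant of `z` on the lower triangle at `x`. -/
def gradLo (ε : ℝ) (z : (Fin 2 → ℤ) → EuclideanSpace ℝ (Fin 2)) (x : Fin 2 → ℤ) : Mat2 :=
  fun i j => (WithLp.equiv 2 (Fin 2 → ℝ)) (fd2 ε (eint j) z x) i

/-- Gradient of the piecewise affine interpolant of `z` on the upper triangle at `x`. -/
def gradUp (ε : ℝ) (z : (Fin 2 → ℤ) → EuclideanSpace ℝ (Fin 2)) (x : Fin 2 → ℤ) : Mat2 :=
  fun i j => (WithLp.equiv 2 (Fin 2 → ℝ)) (fd2 ε (eint j) z (x + eint (![1, 0] j))) i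

/-- The (a.e. defined) piecewise constant gradient `∇y : ℝ² → ℝ^{2×2}` of the piecewise
affine interpolant of `y` with respect to the periodic triangulation `𝒯_ε^per`. -/
def gradFn (ε : ℝ) (y : (Fin 2 → ℤ) → EuclideanSpace ℝ (Fin 2))
    (p : EuclideanSpace ℝ (Fin 2)) : Mat2 :=
  let q := (WithLp.equiv 2 (Fin 2 → ℝ)) p
  let x : Fin 2 → ℤ := fun i => ⌊q i / ε⌋
  if (q 0 / ε - (⌊q 0 / ε⌋ : ℝ)) + (q 1 / ε - (⌊q 1 / ε⌋ : ℝ)) ≤ 1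
    then gradLo ε y x else gradUp ε y x

/-- Frobenius norm of a matrix. -/
def frobNorm (A : Mat2) : ℝ := Real.sqrt (∑ i, ∑ j, (A i j) ^ 2)

/-- The oscillation `osc(g; ω) = ess sup_{x,x'∈ω} |g(x) − g(x')|/ε`. -/
def osc (ε : ℝ) (g : EuclideanSpace ℝ (Fin 2) → Mat2) (ω : Set (EuclideanSpace ℝ (Fin 2))) : ℝ :=
  essSup (fun p : EuclideanSpace ℝ (Fin 2) × EuclideanSpace ℝ (Fin 2) =>
      frobNorm (g p.1 - g p.2) / ε)
    ((volume.restrict ω).prod (volume.restrict ω))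

/-- The interaction neighbourhood
`ω_T^a = { x + εt₁r₁ + εt₂r₂ : x ∈ T, t₁,t₂ ∈ [−1,1], r₁,r₂ ∈ ℛ }`. -/
def omegaA (ε : ℝ) (R : Finset (Fin 2 → ℤ)) (T : Set (EuclideanSpace ℝ (Fin 2))) :
    Set (EuclideanSpace ℝ (Fin 2)) :=
  { p | ∃ x ∈ T, ∃ t₁ ∈ Set.Icc (-1 : ℝ) 1, ∃ t₂ ∈ Set.Icc (-1 : ℝ) 1,
      ∃ r₁ ∈ R, ∃ r₂ ∈ R, p = x + (ε * t₁) • zvec r₁ + (ε * t₂) • zvec r₂ }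

/-- The tensor product `a ⊗ r`, `(a ⊗ r)_{ij} = a_i r_j`. -/
def outer (a : EuclideanSpace ℝ (Fin 2)) (r : Fin 2 → ℤ) : Mat2 :=
  fun i j => (WithLp.equiv 2 (Fin 2 → ℝ)) a i * (r j : ℝ)

/-- The bond integral `⨍_x^{x+εr} χ db`. -/
def bondInt (ε : ℝ) (χ : EuclideanSpace ℝ (Fin 2) → ℝ) (x r : Fin 2 → ℤ) : ℝ :=
  ∫ t in (0:ℝ)..1, χ (latpt ε x + t • (ε • zvec r))

/-- `χ` satisfies the defining density limit of `χ_T`. -/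
def IsDensityFn (T : Set (EuclideanSpace ℝ (Fin 2))) (χ : EuclideanSpace ℝ (Fin 2) → ℝ) : Prop :=
  ∀ x : EuclideanSpace ℝ (Fin 2),
    Tendsto (fun t : ℝ =>
        (volume (T ∩ Metric.closedBall x t)).toReal / (volume (Metric.closedBall x t)).toReal)
      (nhdsWithin 0 (Set.Ioi 0)) (nhds (χ x))

/-- The atomistic stress function `Σ_a(y;T)`. -/
def Sa (ε : ℝ) (R : Finset (Fin 2 → ℤ))
    (DV : (R → EuclideanSpace ℝ (Fin 2)) → R → EuclideanSpace ℝ (Fin 2))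
    (y : (Fin 2 → ℤ) → EuclideanSpace ℝ (Fin 2)) (area : ℝ)
    (χ : EuclideanSpace ℝ (Fin 2) → ℝ) : Mat2 :=
  ∑ r : R, (ε ^ 2 / area)
    • ∑' x : Fin 2 → ℤ, bondInt ε χ x (↑r) • outer (DV (fun s => fd2 ε (↑s) y x) r) (↑r)

/-- `Fℛ`: the stencil of the matrix `F`. -/
def stencil (R : Finset (Fin 2 → ℤ)) (F : Mat2) : R → EuclideanSpace ℝ (Fin 2) :=
  fun r => toV2 fun i => ∑ j, F i j * ((r : Fin 2 → ℤ) j : ℝ)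

/-- `∂W(F) = Σ_{r∈ℛ} ∂_r V(Fℛ) ⊗ r`. -/
def pW (R : Finset (Fin 2 → ℤ))
    (DV : (R → EuclideanSpace ℝ (Fin 2)) → R → EuclideanSpace ℝ (Fin 2))
    (F : Mat2) : Mat2 :=
  ∑ r : R, outer (DV (stencil R F) r) (↑r)

/-- Membership in `𝓨`: `y − y_A` is `2ℤ²`-periodic for some matrix `A`. -/
def InY (N : ℕ) (y : (Fin 2 → ℤ) → EuclideanSpace ℝ (Fin 2)) : Prop :=
  ∃ A : Mat2, ∀ x ξ : Fin 2 → ℤ,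
    y (x + (2 * N : ℤ) • ξ) = y x + toV2 fun i => ∑ j, A i j * (2 * (ξ j : ℝ))


/-- The Euclidean plane. -/
abbrev E2 : Type := EuclideanSpace ℝ (Fin 2)

@[simp] theorem toV2_apply (f : Fin 2 → ℝ) (i : Fin 2) : toV2 f i = f i := rfl

@[simp] theorem zvec_apply (r : Fin 2 → ℤ) (i : Fin 2) : zvec r i = r i := rfl

@[simp] theorem latpt_apply (ε : ℝ) (r : Fin 2 → ℤ) (i : Fin 2) : latpt ε r i = ε * r i := rfl

@[simp] theorem eint_zero_zero : eint 0 0 = 1 := rfl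
@[simp] theorem eint_zero_one : eint 0 1 = 0 := rfl
@[simp] theorem eint_one_zero : eint 1 0 = 0 := rfl
@[simp] theorem eint_one_one : eint 1 1 = 1 := rfl

/-- The closed triangle of the mesh at `z`: lower for `b = false`, upper for `b = true`. -/
def meshTri (ε : ℝ) (z : Fin 2 → ℤ) (b : Bool) : Set E2 :=
  if b then Tup ε z else Tlo ε z

/-- The gradient of the interpolant on `meshTri ε z b`. -/
def meshGrad (ε : ℝ) (y : (Fin 2 → ℤ) → E2) (z : Fin 2 → ℤ) (b : Bool) : Mat2 :=
  if b then gradUp ε y z else gradLo ε y z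

/-- The open triangle of the mesh at `z`. -/
def openTri (ε : ℝ) (z : Fin 2 → ℤ) (b : Bool) : Set E2 :=
  {p | if b then p 0 / ε - z 0 < 1 ∧ p 1 / ε - z 1 < 1 ∧ 1 < (p 0 / ε - z 0) + (p 1 / ε - z 1)
    else 0 < p 0 / ε - z 0 ∧ 0 < p 1 / ε - z 1 ∧ (p 0 / ε - z 0) + (p 1 / ε - z 1) < 1}

theorem convex_combination_three {s : Set E2} (hs : Convex ℝ s) {u v w : E2} (hu : u ∈ s)
    (hv : v ∈ s) (hw : w ∈ s) {a b c : ℝ} (ha : 0 ≤ a) (hb : 0 ≤ b) (hc : 0 ≤ c)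
    (h : a + b + c = 1) : a • u + b • v + c • w ∈ s := by
  have := hs.sum_mem (t := Finset.univ) (w := ![a, b, c]) (z := ![u, v, w])
    (by intro i _; fin_cases i <;> simpa) (by simpa [Fin.sum_univ_three] using h)
    (by intro i _; fin_cases i <;> simpa)
  simpa [Fin.sum_univ_three] using this

theorem mem_Tlo {ε : ℝ} (hε : 0 < ε) (z : Fin 2 → ℤ) (p : E2) :
    p ∈ Tlo ε z ↔ 0 ≤ p 0 / ε - z 0 ∧ 0 ≤ p 1 / ε - z 1 ∧
      (p 0 / ε - z 0) + (p 1 / ε - z 1) ≤ 1 := by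
  constructor
  · intro hp
    have hc : Convex ℝ {p : E2 | 0 ≤ p 0 / ε - z 0 ∧ 0 ≤ p 1 / ε - z 1 ∧
        (p 0 / ε - z 0) + (p 1 / ε - z 1) ≤ 1} := by
      rintro p ⟨h1, h2, h3⟩ q ⟨k1, k2, k3⟩ a b ha hb hab
      have e : ∀ i, (a • p + b • q) i / ε - z i = a * (p i / ε - z i) + b * (q i / ε - z i) := by
        intro i
        simp only [PiLp.add_apply, PiLp.smul_apply, smul_eq_mul]
        linear_combination (z i : ℝ) * hab
      simp only [Set.mem_ofPred_eq, e]
      refine ⟨by positivity, by positivity, ?_⟩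
      nlinarith
    refine convexHull_min ?_ hc hp
    rintro q (rfl | rfl | rfl) <;> simp [hε.ne', mul_div_cancel_left₀]
  · rintro ⟨h1, h2, h3⟩
    have : p = (1 - (p 0 / ε - z 0) - (p 1 / ε - z 1)) • latpt ε z +
        (p 0 / ε - z 0) • latpt ε (z + eint 0) + (p 1 / ε - z 1) • latpt ε (z + eint 1) := by
      ext i; fin_cases i <;> simp <;> field_simp <;> ring
    rw [this]
    exact convex_combination_three (convex_convexHull ℝ _)
      (subset_convexHull ℝ _ (by simp)) (subset_convexHull ℝ _ (by simp))
      (subset_convexHull ℝ _ (by simp)) (by linarith) h1 h2 (by ring)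

theorem mem_Tup {ε : ℝ} (hε : 0 < ε) (z : Fin 2 → ℤ) (p : E2) :
    p ∈ Tup ε z ↔ p 0 / ε - z 0 ≤ 1 ∧ p 1 / ε - z 1 ≤ 1 ∧
      1 ≤ (p 0 / ε - z 0) + (p 1 / ε - z 1) := by
  constructor
  · intro hp
    have hc : Convex ℝ {p : E2 | p 0 / ε - z 0 ≤ 1 ∧ p 1 / ε - z 1 ≤ 1 ∧
        1 ≤ (p 0 / ε - z 0) + (p 1 / ε - z 1)} := by
      rintro p ⟨h1, h2, h3⟩ q ⟨k1, k2, k3⟩ a b ha hb hab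
      have e : ∀ i, (a • p + b • q) i / ε - z i = a * (p i / ε - z i) + b * (q i / ε - z i) := by
        intro i
        simp only [PiLp.add_apply, PiLp.smul_apply, smul_eq_mul]
        linear_combination (z i : ℝ) * hab
      simp only [Set.mem_ofPred_eq, e]
      refine ⟨?_, ?_, ?_⟩ <;> nlinarith
    refine convexHull_min ?_ hc hp
    rintro q (rfl | rfl | rfl) <;> simp [hε.ne', mul_div_cancel_left₀, add_comm]
  · rintro ⟨h1, h2, h3⟩
    have : p = (1 - (p 1 / ε - z 1)) • latpt ε (z + eint 0) +
        (1 - (p 0 / ε - z 0)) • latpt ε (z + eint 1) +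
        ((p 0 / ε - z 0) + (p 1 / ε - z 1) - 1) • latpt ε (z + eint 0 + eint 1) := by
      ext i; fin_cases i <;> simp <;> field_simp <;> ring
    rw [this]
    exact convex_combination_three (convex_convexHull ℝ _)
      (subset_convexHull ℝ _ (by simp)) (subset_convexHull ℝ _ (by simp))
      (subset_convexHull ℝ _ (by simp)) (by linarith) (by linarith) (by linarith) (by ring)

theorem mem_meshTri {ε : ℝ} (hε : 0 < ε) (z : Fin 2 → ℤ) (b : Bool) (p : E2) :
    p ∈ meshTri ε z b ↔
      if b then p 0 / ε - z 0 ≤ 1 ∧ p 1 / ε - z 1 ≤ 1 ∧ 1 ≤ (p 0 / ε - z 0) + (p 1 / ε - z 1)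
      else 0 ≤ p 0 / ε - z 0 ∧ 0 ≤ p 1 / ε - z 1 ∧ (p 0 / ε - z 0) + (p 1 / ε - z 1) ≤ 1 := by
  cases b
  · simpa [meshTri] using mem_Tlo hε z p
  · simpa [meshTri] using mem_Tup hε z p

theorem isClosed_meshTri {ε : ℝ} (z : Fin 2 → ℤ) (b : Bool) :
    IsClosed (meshTri ε z b) := by
  cases b <;> simp only [meshTri, Tlo, Tup] <;>
    exact (Set.Finite.isCompact_convexHull ℝ (by simp)).isClosed

theorem isOpen_openTri (ε : ℝ) (z : Fin 2 → ℤ) (b : Bool) : IsOpen (openTri ε z b) := by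
  cases b <;> simp only [openTri, Bool.false_eq_true, if_false, if_true, Set.ofPred_and]
  · refine ((isOpen_lt (by fun_prop) (by fun_prop)).inter
      ((isOpen_lt (by fun_prop) (by fun_prop)).inter (isOpen_lt (by fun_prop) (by fun_prop))))
  · refine ((isOpen_lt (by fun_prop) (by fun_prop)).inter
      ((isOpen_lt (by fun_prop) (by fun_prop)).inter (isOpen_lt (by fun_prop) (by fun_prop))))

theorem openTri_subset_meshTri {ε : ℝ} (hε : 0 < ε) (z : Fin 2 → ℤ) (b : Bool) :
    openTri ε z b ⊆ meshTri ε z b := by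
  intro p hp
  rw [mem_meshTri hε]
  cases b <;> simp only [openTri, Bool.false_eq_true, if_false, if_true, Set.mem_ofPred_eq] at hp ⊢
  all_goals exact ⟨hp.1.le, hp.2.1.le, hp.2.2.le⟩

/-- The barycentre of a mesh triangle. -/
def meshCentre (ε : ℝ) (z : Fin 2 → ℤ) (b : Bool) : E2 :=
  toV2 fun i => ε * (z i + if b then 2 / 3 else 1 / 3)

theorem lineMap_mem_openTri {ε : ℝ} (hε : 0 < ε) {z : Fin 2 → ℤ} {b : Bool} {p : E2}
    (hp : p ∈ meshTri ε z b) {η : ℝ} (h0 : 0 < η) (h1 : η < 1) :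
    p + η • (meshCentre ε z b - p) ∈ openTri ε z b := by
  rw [mem_meshTri hε] at hp
  have e : ∀ i, (p + η • (meshCentre ε z b - p)) i / ε - z i =
      (1 - η) * (p i / ε - z i) + η * (if b then 2 / 3 else 1 / 3) := by
    intro i
    cases b <;> simp [meshCentre] <;> field_simp <;> ring
  simp only [openTri, Set.mem_ofPred_eq, e]
  cases b <;> simp only [Bool.false_eq_true, if_false, if_true] at hp ⊢
  · obtain ⟨h1, h2, h3⟩ := hp
    refine ⟨?_, ?_, ?_⟩ <;> nlinarith
  · obtain ⟨h1, h2, h3⟩ := hp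
    refine ⟨?_, ?_, ?_⟩ <;> nlinarith

theorem tendsto_lineMap_centre (ε : ℝ) (z : Fin 2 → ℤ) (b : Bool) (p : E2) :
    Tendsto (fun η : ℝ => p + η • (meshCentre ε z b - p)) (nhdsWithin 0 (Set.Ioi 0)) (nhds p) := by
  have : Continuous (fun η : ℝ => p + η • (meshCentre ε z b - p)) := by fun_prop
  have h := this.tendsto 0
  simp only [zero_smul, add_zero] at h
  exact h.mono_left nhdsWithin_le_nhds

theorem eventually_lineMap_mem_openTri {ε : ℝ} (hε : 0 < ε) {z : Fin 2 → ℤ} {b : Bool} {p : E2}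
    (hp : p ∈ meshTri ε z b) :
    ∀ᶠ η : ℝ in nhdsWithin 0 (Set.Ioi 0), p + η • (meshCentre ε z b - p) ∈ openTri ε z b := by
  filter_upwards [Ioo_mem_nhdsGT (zero_lt_one' ℝ)] with η hη
  exact lineMap_mem_openTri hε hp hη.1 hη.2

theorem gradFn_of_mem_openTri {ε : ℝ} {z : Fin 2 → ℤ} {b : Bool} {p : E2}
    (hp : p ∈ openTri ε z b) (y : (Fin 2 → ℤ) → E2) :
    gradFn ε y p = meshGrad ε y z b := by
  have hf : ∀ i, ⌊p i / ε⌋ = z i := by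
    intro i
    rw [Int.floor_eq_iff]
    cases b <;> simp only [openTri, Bool.false_eq_true, if_false, if_true, Set.mem_ofPred_eq] at hp
      <;> obtain ⟨h1, h2, h3⟩ := hp <;> fin_cases i <;> constructor <;> simp <;> linarith
  have hz : (fun i => ⌊p i / ε⌋) = z := funext hf
  have h0 := hf 0
  have h1 := hf 1
  simp only [gradFn, WithLp.equiv_apply, hz, h0, h1, meshGrad]
  cases b <;> simp only [openTri, Bool.false_eq_true, if_false, if_true, Set.mem_ofPred_eq] at hp ⊢
  · rw [if_pos hp.2.2.le]
  · rw [if_neg (not_le.2 hp.2.2)]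

/-- Action of a matrix on the plane. -/
def matVec (G : Mat2) (d : E2) : E2 := toV2 fun i => ∑ j, G i j * d j

theorem matVec_apply (G : Mat2) (d : E2) (i : Fin 2) :
    matVec G d i = G i 0 * d 0 + G i 1 * d 1 := by
  simp [matVec, Fin.sum_univ_two]

theorem matVec_sub_left (G H : Mat2) (d : E2) :
    matVec (G - H) d = matVec G d - matVec H d := by
  ext i; simp [matVec_apply]; ring

theorem matVec_smul (G : Mat2) (c : ℝ) (d : E2) : matVec G (c • d) = c • matVec G d := by
  ext i; simp [matVec_apply]; ring

theorem matVec_zero (G : Mat2) : matVec G 0 = 0 := by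
  ext i; simp [matVec_apply]

theorem continuous_matVec (G : Mat2) : Continuous (matVec G) := by
  unfold matVec toV2
  simp only [WithLp.equiv_symm_apply]
  fun_prop

theorem norm_matVec_le (G : Mat2) (d : E2) : ‖matVec G d‖ ≤ frobNorm G * ‖d‖ := by
  rw [EuclideanSpace.norm_eq, EuclideanSpace.norm_eq, frobNorm, ← Real.sqrt_mul (by positivity)]
  apply Real.sqrt_le_sqrt
  simp only [Fin.sum_univ_two, matVec_apply, Real.norm_eq_abs, sq_abs]
  nlinarith [sq_nonneg (G 0 0 * d 1 - G 0 1 * d 0), sq_nonneg (G 1 0 * d 1 - G 1 1 * d 0)]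

theorem stencil_apply (R : Finset (Fin 2 → ℤ)) (F : Mat2) (s : R) :
    stencil R F s = matVec F (zvec s) := rfl

/-- Interpolation formula on the closed cell at `z`. -/
def cellInterp (ε : ℝ) (y : (Fin 2 → ℤ) → E2) (z : Fin 2 → ℤ) (p : E2) : E2 :=
  y z + (p 0 / ε - z 0) • (y (z + eint 0) - y z) + (p 1 / ε - z 1) • (y (z + eint 1) - y z) +
    max 0 ((p 0 / ε - z 0) + (p 1 / ε - z 1) - 1) •
      (y (z + eint 0 + eint 1) - y (z + eint 0) - y (z + eint 1) + y z)

/-- The closed cell at `z`. -/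
def closedCell (ε : ℝ) (z : Fin 2 → ℤ) : Set E2 :=
  {p | ∀ i, 0 ≤ p i / ε - z i ∧ p i / ε - z i ≤ 1}

/-- The continuous piecewise affine interpolant of `y`. -/
def interp (ε : ℝ) (y : (Fin 2 → ℤ) → E2) (p : E2) : E2 :=
  cellInterp ε y (fun i => ⌊p i / ε⌋) p

theorem continuous_cellInterp (ε : ℝ) (y : (Fin 2 → ℤ) → E2) (z : Fin 2 → ℤ) :
    Continuous (cellInterp ε y z) := by
  unfold cellInterp
  fun_prop

theorem cellInterp_add_eint_zero {ε : ℝ} (y : (Fin 2 → ℤ) → E2) (z : Fin 2 → ℤ) {p : E2}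
    (h0 : p 0 / ε = z 0 + 1) (h1 : 0 ≤ p 1 / ε - z 1 ∧ p 1 / ε - z 1 ≤ 1) :
    cellInterp ε y (z + eint 0) p = cellInterp ε y z p := by
  simp only [cellInterp, Pi.add_apply, eint_zero_zero, eint_zero_one, h0, Int.cast_add,
    Int.cast_one, Int.cast_zero]
  rw [max_eq_left (by linarith), max_eq_right (by linarith)]
  module

theorem cellInterp_add_eint_one {ε : ℝ} (y : (Fin 2 → ℤ) → E2) (z : Fin 2 → ℤ) {p : E2}
    (h0 : p 1 / ε = z 1 + 1) (h1 : 0 ≤ p 0 / ε - z 0 ∧ p 0 / ε - z 0 ≤ 1) :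
    cellInterp ε y (z + eint 1) p = cellInterp ε y z p := by
  have e1 : z + eint 1 + eint 0 = z + eint 0 + eint 1 := by abel
  simp only [cellInterp, Pi.add_apply, eint_one_zero, eint_one_one, h0, Int.cast_add,
    Int.cast_one, Int.cast_zero, e1]
  rw [max_eq_left (by linarith), max_eq_right (by linarith)]
  module

theorem interp_eq_cellInterp {ε : ℝ} (y : (Fin 2 → ℤ) → E2) {z : Fin 2 → ℤ} {p : E2}
    (hp : p ∈ closedCell ε z) : interp ε y p = cellInterp ε y z p := by
  have key : ∀ i, ⌊p i / ε⌋ = z i ∨ (⌊p i / ε⌋ = z i + 1 ∧ p i / ε = z i + 1) := by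
    intro i
    rcases (hp i).2.lt_or_eq with h | h
    · left
      rw [Int.floor_eq_iff]
      exact ⟨by linarith [(hp i).1], by linarith⟩
    · right
      have : p i / ε = z i + 1 := by linarith
      refine ⟨?_, this⟩
      rw [this, Int.floor_add_one, Int.floor_intCast]
  unfold interp
  rcases key 0 with h0 | ⟨h0, k0⟩ <;> rcases key 1 with h1 | ⟨h1, k1⟩
  · congr 1; ext i; fin_cases i <;> simp [h0, h1]
  · rw [← cellInterp_add_eint_one y z k1 (hp 0)]
    congr 1; ext i; fin_cases i <;> simp [h0, h1]
  · rw [← cellInterp_add_eint_zero y z k0 (hp 1)]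
    congr 1; ext i; fin_cases i <;> simp [h0, h1]
  · rw [← cellInterp_add_eint_zero y z k0 (hp 1), ← cellInterp_add_eint_one y (z + eint 0)]
    · congr 1; ext i; fin_cases i <;> simp [h0, h1]
    · simpa using k1
    · simp [k0]

theorem mem_closedCell_floor (ε : ℝ) (p : E2) : p ∈ closedCell ε fun i => ⌊p i / ε⌋ := by
  intro i
  exact ⟨by linarith [Int.floor_le (p i / ε)], by linarith [Int.lt_floor_add_one (p i / ε)]⟩

theorem isClosed_closedCell (ε : ℝ) (z : Fin 2 → ℤ) : IsClosed (closedCell ε z) := by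
  have : closedCell ε z = ⋂ i, ({p : E2 | 0 ≤ p i / ε - z i} ∩ {p : E2 | p i / ε - z i ≤ 1}) := by
    ext p; simp [closedCell]
  rw [this]
  refine isClosed_iInter fun i => (isClosed_le (by fun_prop) (by fun_prop)).inter
    (isClosed_le (by fun_prop) (by fun_prop))

theorem locallyFinite_closedCell (ε : ℝ) : LocallyFinite (closedCell ε) := by
  intro p
  refine ⟨{q : E2 | ∀ i, p i / ε - 1 < q i / ε ∧ q i / ε < p i / ε + 1}, ?_, ?_⟩
  · have : IsOpen {q : E2 | ∀ i, p i / ε - 1 < q i / ε ∧ q i / ε < p i / ε + 1} := by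
      have : {q : E2 | ∀ i, p i / ε - 1 < q i / ε ∧ q i / ε < p i / ε + 1} =
          ⋂ i, ({q : E2 | p i / ε - 1 < q i / ε} ∩ {q : E2 | q i / ε < p i / ε + 1}) := by
        ext q; simp
      rw [this]
      exact isOpen_iInter_of_finite fun i => (isOpen_lt (by fun_prop) (by fun_prop)).inter
        (isOpen_lt (by fun_prop) (by fun_prop))
    exact this.mem_nhds fun i => ⟨by linarith, by linarith⟩
  · refine (Set.finite_Icc (fun i => ⌊p i / ε⌋ - 2) (fun i => ⌊p i / ε⌋ + 2)).subset ?_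
    rintro z ⟨q, hq, hq'⟩
    refine ⟨fun i => ?_, fun i => ?_⟩
    · have h1 := hq i; have h2 := hq' i; have h3 := Int.floor_le (p i / ε)
      have : ((⌊p i / ε⌋ - 2 : ℤ) : ℝ) ≤ z i := by push_cast; linarith
      exact_mod_cast this
    · have h1 := hq i; have h2 := hq' i; have h3 := Int.lt_floor_add_one (p i / ε)
      have : (z i : ℝ) ≤ ((⌊p i / ε⌋ + 2 : ℤ) : ℝ) := by push_cast; linarith
      exact_mod_cast this

theorem continuous_interp (ε : ℝ) (y : (Fin 2 → ℤ) → E2) : Continuous (interp ε y) := by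
  refine (locallyFinite_closedCell ε).continuous ?_ (isClosed_closedCell ε) fun z =>
    ((continuous_cellInterp ε y z).continuousOn).congr fun p hp => interp_eq_cellInterp y hp
  exact Set.iUnion_eq_univ_iff.2 fun p => ⟨_, mem_closedCell_floor ε p⟩

theorem interp_latpt {ε : ℝ} (hε : 0 < ε) (y : (Fin 2 → ℤ) → E2) (z : Fin 2 → ℤ) :
    interp ε y (latpt ε z) = y z := by
  rw [interp_eq_cellInterp (z := z) y (by intro i; simp [hε.ne'])]
  simp [cellInterp, hε.ne']

theorem meshTri_subset_closedCell {ε : ℝ} (hε : 0 < ε) (z : Fin 2 → ℤ) (b : Bool) :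
    meshTri ε z b ⊆ closedCell ε z := by
  intro p hp
  rw [mem_meshTri hε] at hp
  cases b <;> simp only [Bool.false_eq_true, if_false, if_true] at hp <;>
    obtain ⟨h1, h2, h3⟩ := hp <;> intro i <;> fin_cases i <;> constructor <;> simp <;> linarith

theorem interp_sub_interp {ε : ℝ} (hε : 0 < ε) (y : (Fin 2 → ℤ) → E2) {z : Fin 2 → ℤ} {b : Bool}
    {p q : E2} (hp : p ∈ meshTri ε z b) (hq : q ∈ meshTri ε z b) :
    interp ε y p - interp ε y q = matVec (meshGrad ε y z b) (p - q) := by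
  rw [interp_eq_cellInterp y (meshTri_subset_closedCell hε z b hp),
    interp_eq_cellInterp y (meshTri_subset_closedCell hε z b hq)]
  rw [mem_meshTri hε] at hp hq
  have e1 : z + eint 1 + eint 0 = z + eint 0 + eint 1 := by abel
  ext i
  cases b <;> simp only [Bool.false_eq_true, if_false, if_true] at hp hq
  · simp only [cellInterp, max_eq_left (sub_nonpos.2 hp.2.2), max_eq_left (sub_nonpos.2 hq.2.2),
      matVec_apply, meshGrad]
    simp [gradLo, fd2]
    field_simp
    ring
  · simp only [cellInterp, max_eq_right (sub_nonneg.2 hp.2.2), max_eq_right (sub_nonneg.2 hq.2.2),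
      matVec_apply, meshGrad]
    simp [gradUp, fd2, e1]
    field_simp
    ring

theorem exists_int_interval (a d : ℝ) :
    ∃ n : ℤ, ∃ h : ℝ, 0 < h ∧ ∀ t ∈ Set.Icc 0 h, (n : ℝ) ≤ a + t * d ∧ a + t * d ≤ n + 1 := by
  rcases le_or_gt 0 d with hd | hd
  · have h1 := Int.floor_le a
    have h2 := Int.lt_floor_add_one a
    refine ⟨⌊a⌋, (⌊a⌋ + 1 - a) / (d + 1), div_pos (by linarith) (by linarith), ?_⟩
    rintro t ⟨t0, t1⟩
    rw [le_div_iff₀ (by linarith)] at t1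
    constructor <;> nlinarith
  · have h1 := Int.le_ceil a
    have h2 := Int.ceil_lt_add_one a
    refine ⟨⌈a⌉ - 1, (a - (⌈a⌉ - 1)) / (1 - d), div_pos (by linarith) (by linarith), ?_⟩
    rintro t ⟨t0, t1⟩
    rw [le_div_iff₀ (by linarith)] at t1
    push_cast
    constructor <;> nlinarith

theorem exists_meshTri_of_direction {ε : ℝ} (hε : 0 < ε) (q d : E2) :
    ∃ z b, ∃ h : ℝ, 0 < h ∧ ∀ t ∈ Set.Icc 0 h, q + t • d ∈ meshTri ε z b := by
  obtain ⟨n0, h0, hh0, H0⟩ := exists_int_interval (q 0 / ε) (d 0 / ε)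
  obtain ⟨n1, h1, hh1, H1⟩ := exists_int_interval (q 1 / ε) (d 1 / ε)
  obtain ⟨m, h2, hh2, H2⟩ := exists_int_interval ((q 0 / ε - n0) + (q 1 / ε - n1))
    (d 0 / ε + d 1 / ε)
  have e : ∀ t i, (q + t • d) i / ε = q i / ε + t * (d i / ε) := by
    intro t i; simp; ring
  refine ⟨![n0, n1], decide (1 ≤ m), min h0 (min h1 h2), by positivity, ?_⟩
  rintro t ⟨t0, t1⟩
  obtain ⟨a1, a2⟩ := H0 t ⟨t0, t1.trans (min_le_left _ _)⟩
  obtain ⟨b1, b2⟩ := H1 t ⟨t0, t1.trans ((min_le_right _ _).trans (min_le_left _ _))⟩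
  obtain ⟨c1, c2⟩ := H2 t ⟨t0, t1.trans ((min_le_right _ _).trans (min_le_right _ _))⟩
  rw [mem_meshTri hε]
  simp only [e]
  by_cases hm : 1 ≤ m
  · have : (1 : ℝ) ≤ m := by exact_mod_cast hm
    simp only [hm, decide_true, if_true]
    refine ⟨?_, ?_, ?_⟩ <;> simp <;> linarith
  · have : (m : ℝ) ≤ 0 := by exact_mod_cast (by omega : m ≤ 0)
    simp only [hm, decide_false, Bool.false_eq_true, if_false]
    refine ⟨?_, ?_, ?_⟩ <;> simp <;> linarith

theorem frobNorm_eq (A : Mat2) :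
    frobNorm A = ‖WithLp.toLp 2 (fun ij : Fin 2 × Fin 2 => A ij.1 ij.2)‖ := by
  simp [frobNorm, EuclideanSpace.norm_eq, Fintype.sum_prod_type]

theorem frobNorm_zero : frobNorm 0 = 0 := by simp [frobNorm]

theorem frobNorm_add_le (A B : Mat2) : frobNorm (A + B) ≤ frobNorm A + frobNorm B := by
  simp only [frobNorm_eq]
  exact norm_add_le (WithLp.toLp 2 (fun ij : Fin 2 × Fin 2 => A ij.1 ij.2))
    (WithLp.toLp 2 (fun ij : Fin 2 × Fin 2 => B ij.1 ij.2))

theorem frobNorm_sum_le {ι : Type*} (s : Finset ι) (f : ι → Mat2) :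
    frobNorm (∑ i ∈ s, f i) ≤ ∑ i ∈ s, frobNorm (f i) :=
  Finset.le_sum_of_subadditive frobNorm frobNorm_zero.le frobNorm_add_le s f

theorem frobNorm_smul {c : ℝ} (hc : 0 ≤ c) (A : Mat2) : frobNorm (c • A) = c * frobNorm A := by
  rw [frobNorm_eq, frobNorm_eq, ← abs_of_nonneg hc, ← Real.norm_eq_abs, ← norm_smul,
    Real.norm_eq_abs, abs_of_nonneg hc]
  rfl

theorem frobNorm_outer (a : E2) (r : Fin 2 → ℤ) : frobNorm (outer a r) = ‖a‖ * ‖zvec r‖ := by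
  rw [frobNorm, EuclideanSpace.norm_eq, EuclideanSpace.norm_eq, ← Real.sqrt_mul (by positivity)]
  congr 1
  simp only [Fin.sum_univ_two, outer, WithLp.equiv_apply, zvec_apply, Real.norm_eq_abs, sq_abs]
  ring

theorem frobNorm_sub_le (A B : Mat2) : frobNorm (A - B) ≤ frobNorm A + frobNorm B := by
  simp only [frobNorm_eq]
  exact norm_sub_le (WithLp.toLp 2 (fun ij : Fin 2 × Fin 2 => A ij.1 ij.2))
    (WithLp.toLp 2 (fun ij : Fin 2 × Fin 2 => B ij.1 ij.2))

theorem exists_norm_le_of_periodic {α : Type*} {m : ℤ} (hm : 0 < m) (u : (Fin 2 → ℤ) → α)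
    (hu : ∀ x ξ : Fin 2 → ℤ, u (x + m • ξ) = u x) (f : α → ℝ) : ∃ C, ∀ x, f (u x) ≤ C := by
  obtain ⟨C, hC⟩ := ((Set.finite_Icc (0 : Fin 2 → ℤ) (fun _ => m)).image (f ∘ u)).bddAbove
  refine ⟨C, fun x => ?_⟩
  have : u x = u (fun i => x i % m) := by
    rw [← hu (fun i => x i % m) (fun i => x i / m)]
    congr 1
    ext i
    simp [Int.emod_add_mul_ediv]
  rw [this]
  exact hC ⟨_, ⟨fun i => Int.emod_nonneg _ hm.ne', fun i => (Int.emod_lt_of_pos _ hm).le⟩, rfl⟩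

theorem fd2_periodic {N : ℕ} {y : (Fin 2 → ℤ) → E2} (hy : InY N y) (ε : ℝ) (r x ξ : Fin 2 → ℤ) :
    fd2 ε r y (x + (2 * N : ℤ) • ξ) = fd2 ε r y x := by
  obtain ⟨A, hA⟩ := hy
  unfold fd2
  rw [add_right_comm, hA, hA]
  congr 1
  abel

theorem exists_frobNorm_gradFn_le {N : ℕ} (hN : 1 ≤ N) {y : (Fin 2 → ℤ) → E2} (hy : InY N y)
    (ε : ℝ) : ∃ C, ∀ p, frobNorm (gradFn ε y p) ≤ C := by
  have hm : (0 : ℤ) < 2 * N := by positivity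
  obtain ⟨C, hC⟩ := exists_norm_le_of_periodic hm (gradLo ε y)
    (fun x ξ => by ext i j; simp only [gradLo, fd2_periodic hy]) frobNorm
  obtain ⟨C', hC'⟩ := exists_norm_le_of_periodic hm (gradUp ε y)
    (fun x ξ => by
      ext i j
      simp only [gradUp, add_right_comm x, fd2_periodic hy]) frobNorm
  refine ⟨max C C', fun p => ?_⟩
  unfold gradFn
  simp only
  split_ifs
  · exact (hC _).trans (le_max_left _ _)
  · exact (hC' _).trans (le_max_right _ _)

/-- Values of a bounded gradient field on open subsets of `ω` differ by at most the oscillation. -/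
theorem frobNorm_sub_le_osc {ε : ℝ} (hε : 0 < ε) {g : E2 → Mat2} {C : ℝ}
    (hC : ∀ p, frobNorm (g p) ≤ C) {ω U W : Set E2} (hU : IsOpen U) (hW : IsOpen W)
    (hUne : U.Nonempty) (hWne : W.Nonempty) (hUω : U ⊆ ω) (hWω : W ⊆ ω) {G F : Mat2}
    (hG : ∀ p ∈ U, g p = G) (hF : ∀ p ∈ W, g p = F) :
    frobNorm (G - F) ≤ ε * osc ε g ω := by
  set μ : Measure (E2 × E2) := (volume.restrict ω).prod (volume.restrict ω) with hμ
  have hbdd : IsBoundedUnder (· ≤ ·) (ae μ)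
      (fun p : E2 × E2 => frobNorm (g p.1 - g p.2) / ε) := by
    refine isBoundedUnder_of ⟨(C + C) / ε, fun p => ?_⟩
    gcongr
    exact (frobNorm_sub_le _ _).trans (add_le_add (hC _) (hC _))
  have hae := ae_le_essSup hbdd
  have hpos : μ (U ×ˢ W) ≠ 0 := by
    rw [hμ, Measure.prod_prod, Measure.restrict_apply hU.measurableSet,
      Measure.restrict_apply hW.measurableSet, Set.inter_eq_left.2 hUω, Set.inter_eq_left.2 hWω]
    exact mul_ne_zero (hU.measure_pos _ hUne).ne' (hW.measure_pos _ hWne).ne'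
  obtain ⟨p, hp, hle⟩ : ∃ p ∈ U ×ˢ W, frobNorm (g p.1 - g p.2) / ε ≤ osc ε g ω := by
    by_contra! hcon
    refine hpos (measure_mono_null (fun p hp => ?_) (ae_iff.1 hae))
    exact not_le.2 (hcon p hp)
  rw [hG _ hp.1, hF _ hp.2, div_le_iff₀ hε] at hle
  linarith

theorem matVec_add_right (G : Mat2) (d e : E2) : matVec G (d + e) = matVec G d + matVec G e := by
  ext i; simp [matVec_apply]; ring

theorem norm_interp_sub_le {ε : ℝ} (hε : 0 < ε) (y : (Fin 2 → ℤ) → E2) (F : Mat2) {U : Set E2}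
    (hU : IsOpen U) {L : ℝ}
    (hL : ∀ z b, (U ∩ openTri ε z b).Nonempty → frobNorm (meshGrad ε y z b - F) ≤ L)
    (p d : E2) (hpd : ∀ t ∈ Set.Icc (0 : ℝ) 1, p + t • d ∈ U) :
    ‖interp ε y (p + d) - interp ε y p - matVec F d‖ ≤ L * ‖d‖ := by
  set φ : ℝ → E2 := fun t => interp ε y (p + t • d) - matVec F (p + t • d) with hφ
  have hcont : Continuous φ :=
    ((continuous_interp ε y).comp (by fun_prop)).sub ((continuous_matVec F).comp (by fun_prop))
  have hder : ∀ t ∈ Set.Ico (0 : ℝ) 1,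
      ∃ v : E2, HasDerivWithinAt φ v (Set.Ici t) t ∧ ‖v‖ ≤ L * ‖d‖ := by
    intro t ht
    obtain ⟨z, b, h, hh, H⟩ := exists_meshTri_of_direction hε (p + t • d) d
    refine ⟨matVec (meshGrad ε y z b - F) d, ?_, ?_⟩
    · have h1 : HasDerivWithinAt
          (fun s : ℝ => φ t + (s - t) • matVec (meshGrad ε y z b - F) d)
          (matVec (meshGrad ε y z b - F) d) (Set.Ici t) t := by
        have := (((hasDerivAt_id t).sub_const t).smul_const
          (matVec (meshGrad ε y z b - F) d)).const_add (φ t)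
        simpa using this.hasDerivWithinAt
      have heq : ∀ s ∈ Set.Icc t (t + h),
          φ s = φ t + (s - t) • matVec (meshGrad ε y z b - F) d := by
        intro s hs
        have hs' := H (s - t) ⟨by linarith [hs.1], by linarith [hs.2]⟩
        have ht' := H 0 ⟨le_rfl, hh.le⟩
        rw [add_assoc, ← add_smul, add_sub_cancel] at hs'
        rw [zero_smul, add_zero] at ht'
        have e := interp_sub_interp hε y hs' ht'
        rw [add_sub_add_left_eq_sub, ← sub_smul, matVec_smul] at e
        simp only [hφ, matVec_add_right, matVec_smul, matVec_sub_left]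
        rw [sub_eq_iff_eq_add] at e
        rw [e]
        module
      refine h1.congr_of_eventuallyEq ?_ (by simp)
      filter_upwards [Icc_mem_nhdsGE (by linarith : t < t + h)] with s hs using heq s hs
    · refine (norm_matVec_le _ _).trans (mul_le_mul_of_nonneg_right (hL z b ?_) (norm_nonneg _))
      have hq := H 0 ⟨le_rfl, hh.le⟩
      rw [zero_smul, add_zero] at hq
      have h1 := eventually_lineMap_mem_openTri hε hq
      have h2 := (tendsto_lineMap_centre ε z b (p + t • d)).eventually
        (hU.mem_nhds (hpd t ⟨ht.1, ht.2.le⟩))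
      obtain ⟨η, h3, h4⟩ := (h1.and h2).exists
      exact ⟨_, h4, h3⟩
  choose! v hv hvL using hder
  have := norm_image_sub_le_of_norm_deriv_right_le_segment hcont.continuousOn hv hvL 1
    ⟨zero_le_one, le_rfl⟩
  simp only [hφ, one_smul, zero_smul, add_zero, sub_zero, mul_one, matVec_add_right, matVec_zero] at this
  refine le_of_eq_of_le (congrArg norm ?_) this
  abel

/-- If a bond at `z` meets the triangle, the finite differences at `z` are close to its gradient. -/
theorem norm_fd2_sub_stencil_le {N : ℕ} (hN : 1 ≤ N) {ε : ℝ} (hε : 0 < ε)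
    (R : Finset (Fin 2 → ℤ)) {y : (Fin 2 → ℤ) → E2} (hy : InY N y)
    (x : Fin 2 → ℤ) (b : Bool) (r s : R) (z : Fin 2 → ℤ) {t : ℝ} (ht : t ∈ Set.Icc (0 : ℝ) 1)
    (hz : latpt ε z + t • (ε • zvec r) ∈ meshTri ε x b) :
    ‖fd2 ε s y z - stencil R (meshGrad ε y x b) s‖ ≤
      (ε * osc ε (gradFn ε y) (omegaA ε R (meshTri ε x b))) * ‖zvec s‖ := by
  set ω := omegaA ε R (meshTri ε x b)
  set L := ε * osc ε (gradFn ε y) ω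
  set F := meshGrad ε y x b
  set p0 := latpt ε z + t • (ε • zvec r) with hp0
  obtain ⟨C, hC⟩ := exists_frobNorm_gradFn_le hN hy ε
  have hTω : openTri ε x b ⊆ ω := fun q hq =>
    ⟨q, openTri_subset_meshTri hε x b hq, 0, by simp, 0, by simp, r, r.2, r, r.2, by simp⟩
  have hL : ∀ z b, (interior ω ∩ openTri ε z b).Nonempty →
      frobNorm (meshGrad ε y z b - F) ≤ L := fun z' b' hne =>
    frobNorm_sub_le_osc hε hC (isOpen_interior.inter (isOpen_openTri ε z' b'))
      (isOpen_openTri ε x b) hne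
      (let ⟨_, h⟩ := (eventually_lineMap_mem_openTri hε hz).exists; ⟨_, h⟩)
      (Set.inter_subset_left.trans interior_subset) hTω
      (fun q hq => gradFn_of_mem_openTri hq.2 y) (fun q hq => gradFn_of_mem_openTri hq y)
  have hshift : ∀ w ∈ openTri ε x b, ∀ τ ∈ Set.Icc (0 : ℝ) 1,
      (w - t • (ε • zvec r)) + τ • (ε • zvec s) ∈ interior ω := by
    intro w hw τ hτ
    set v : E2 := - (t • (ε • zvec r)) + τ • (ε • zvec s) with hv
    have hopen : IsOpen ((fun q : E2 => q - v) ⁻¹' openTri ε x b) :=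
      (isOpen_openTri ε x b).preimage (by fun_prop)
    refine interior_maximal ?_ hopen ?_
    · intro q hq
      refine ⟨q - v, openTri_subset_meshTri hε x b hq, -t, ⟨by linarith [ht.2], by linarith [ht.1]⟩,
        τ, ⟨by linarith [hτ.1], hτ.2⟩, r, r.2, s, s.2, ?_⟩
      rw [hv]
      module
    · have : (w - t • (ε • zvec r)) + τ • (ε • zvec s) - v = w := by rw [hv]; module
      simpa [this] using hw
  have hnear : ∀ w ∈ openTri ε x b,
      ‖interp ε y ((w - t • (ε • zvec r)) + ε • zvec s) - interp ε y (w - t • (ε • zvec r)) -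
        matVec F (ε • zvec s)‖ ≤ L * ‖ε • zvec s‖ := fun w hw =>
    norm_interp_sub_le hε y F isOpen_interior hL _ _ (hshift w hw)
  have hlim : ‖interp ε y ((p0 - t • (ε • zvec r)) + ε • zvec s) -
        interp ε y (p0 - t • (ε • zvec r)) - matVec F (ε • zvec s)‖ ≤ L * ‖ε • zvec s‖ := by
    have hcont : Continuous fun w : E2 =>
        ‖interp ε y ((w - t • (ε • zvec r)) + ε • zvec s) - interp ε y (w - t • (ε • zvec r)) -
          matVec F (ε • zvec s)‖ := by
      have := continuous_interp ε y
      fun_prop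
    refine le_of_tendsto ((hcont.tendsto p0).comp (tendsto_lineMap_centre ε x b p0)) ?_
    filter_upwards [eventually_lineMap_mem_openTri hε hz] with η hη using hnear _ hη
  have e1 : p0 - t • (ε • zvec r) = latpt ε z := by rw [hp0]; abel
  have e2 : latpt ε z + ε • zvec s = latpt ε (z + s) := by
    ext i; simp; ring
  rw [e1, e2, interp_latpt hε, interp_latpt hε, matVec_smul, norm_smul, Real.norm_eq_abs,
    abs_of_pos hε] at hlim
  have e3 : fd2 ε s y z - stencil R F s =
      ε⁻¹ • (y (z + s) - y z - ε • matVec F (zvec s)) := by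
    rw [smul_sub, smul_smul, inv_mul_cancel₀ hε.ne', one_smul, stencil_apply]
    rfl
  rw [e3, norm_smul, norm_inv, Real.norm_eq_abs, abs_of_pos hε, inv_mul_le_iff₀ hε]
  linarith

namespace IsDensityFn

variable {T : Set E2} {χ : E2 → ℝ}

theorem nonneg (h : IsDensityFn T χ) (p : E2) : 0 ≤ χ p :=
  ge_of_tendsto' (h p) fun _ => div_nonneg ENNReal.toReal_nonneg ENNReal.toReal_nonneg

theorem le_one (h : IsDensityFn T χ) (p : E2) : χ p ≤ 1 :=
  le_of_tendsto' (h p) fun _ => div_le_one_of_le₀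
    (ENNReal.toReal_mono measure_closedBall_lt_top.ne (measure_mono Set.inter_subset_right))
    ENNReal.toReal_nonneg

theorem eq_zero (h : IsDensityFn T χ) (hT : IsClosed T) {p : E2} (hp : p ∉ T) : χ p = 0 := by
  refine tendsto_nhds_unique_of_eventuallyEq (h p) tendsto_const_nhds ?_
  obtain ⟨δ, hδ, hball⟩ := Metric.isOpen_iff.1 hT.isOpen_compl p hp
  filter_upwards [Ioo_mem_nhdsGT hδ] with t ht
  have : T ∩ Metric.closedBall p t = ∅ := by
    ext q
    simp only [Set.mem_inter_iff, Set.mem_empty_iff_false, iff_false, not_and]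
    exact fun hq hq' => hball (Metric.closedBall_subset_ball ht.2 hq') hq
  simp [this]

theorem measurable (h : IsDensityFn T χ) (hT : MeasurableSet T) : Measurable χ := by
  set u : ℕ → ℝ := fun n => 1 / ((n : ℝ) + 1)
  have hu : Tendsto u atTop (nhdsWithin 0 (Set.Ioi 0)) :=
    tendsto_nhdsWithin_iff.2 ⟨tendsto_one_div_add_atTop_nhds_zero_nat,
      Eventually.of_forall fun n => Set.mem_Ioi.2 Nat.one_div_pos_of_nat⟩
  refine measurable_of_tendsto_metrizable (f := fun n p =>
    (volume (T ∩ Metric.closedBall p (u n))).toReal /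
      (volume (Metric.closedBall p (u n))).toReal) (fun n => ?_)
    (tendsto_pi_nhds.2 fun p => (h p).comp hu)
  simp only [Measure.addHaar_closedBall_center volume]
  refine Measurable.div_const (Measurable.ennreal_toReal ?_) _
  have hs : MeasurableSet {pq : E2 × E2 | pq.2 ∈ T ∧ dist pq.2 pq.1 ≤ u n} :=
    (measurable_snd hT).inter
      (measurableSet_le (measurable_snd.dist measurable_fst) measurable_const)
  exact measurable_measure_prodMk_left hs

theorem reflect (h : IsDensityFn T χ) (c : E2) :
    IsDensityFn ((fun p => c - p) ⁻¹' T) (fun p => χ (c - p)) := by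
  intro p
  refine (h (c - p)).congr fun t => ?_
  rw [Measure.addHaar_closedBall_center, Measure.addHaar_closedBall_center volume p]
  have : (fun q => c - q) ⁻¹' T ∩ Metric.closedBall p t =
      (fun q => c - q) ⁻¹' (T ∩ Metric.closedBall (c - p) t) := by
    ext q
    simp [dist_eq_norm, norm_sub_rev]
  rw [this, (Measure.measurePreserving_sub_left volume c).measure_preimage_emb
    (MeasurableEquiv.subLeft c).measurableEmbedding]

theorem intervalIntegrable (h : IsDensityFn T χ) (hT : MeasurableSet T) (p d : E2) :
    IntervalIntegrable (fun t : ℝ => χ (p + t • d)) volume 0 1 := by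
  rw [intervalIntegrable_iff]
  refine Measure.integrableOn_of_bounded (M := 1) (by simp)
    ((h.measurable hT).comp (by fun_prop)).aestronglyMeasurable
    (Eventually.of_forall fun t => ?_)
  rw [Real.norm_eq_abs, abs_of_nonneg (h.nonneg _)]
  exact h.le_one _

end IsDensityFn

theorem meshTri_reflect {ε : ℝ} (hε : 0 < ε) (x : Fin 2 → ℤ) (b : Bool) :
    (fun p => (latpt ε x + latpt ε (x + eint 0 + eint 1)) - p) ⁻¹' meshTri ε x b =
      meshTri ε x !b := by
  ext p
  have e : ∀ i, ((latpt ε x + latpt ε (x + eint 0 + eint 1)) - p) i / ε - x i =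
      1 - (p i / ε - x i) := by
    intro i; fin_cases i <;> simp <;> field_simp <;> ring
  rw [Set.mem_preimage, mem_meshTri hε, mem_meshTri hε]
  simp only [e]
  cases b <;> simp only [Bool.false_eq_true, Bool.not_false, Bool.not_true, if_false, if_true] <;>
    constructor <;> rintro ⟨h1, h2, h3⟩ <;> refine ⟨?_, ?_, ?_⟩ <;> linarith

theorem volume_meshTri_not {ε : ℝ} (hε : 0 < ε) (x : Fin 2 → ℤ) (b : Bool) :
    volume (meshTri ε x !b) = volume (meshTri ε x b) := by
  rw [← meshTri_reflect hε, (Measure.measurePreserving_sub_left volume _).measure_preimage_emb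
    (MeasurableEquiv.subLeft _).measurableEmbedding]

/-- The index of the half-open lattice cell containing a point. -/
def cellIndex (ε : ℝ) (p : E2) : Fin 2 → ℤ := fun i => ⌊p i / ε⌋

theorem measurable_cellIndex (ε : ℝ) : Measurable (cellIndex ε) := by
  refine measurable_pi_lambda _ fun i => Int.measurable_floor.comp ?_
  fun_prop

theorem measurableSet_cellIndex (ε : ℝ) (z : Fin 2 → ℤ) :
    MeasurableSet (cellIndex ε ⁻¹' {z}) := measurable_cellIndex ε (measurableSet_singleton z)

theorem mem_cellIndex {ε : ℝ} {z : Fin 2 → ℤ} {p : E2} :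
    p ∈ cellIndex ε ⁻¹' {z} ↔ ∀ i, 0 ≤ p i / ε - z i ∧ p i / ε - z i < 1 := by
  simp only [Set.mem_preimage, Set.mem_singleton_iff, cellIndex, funext_iff, Int.floor_eq_iff]
  exact forall_congr' fun i => ⟨fun h => ⟨by linarith, by linarith⟩,
    fun h => ⟨by linarith, by linarith⟩⟩

theorem volume_cellIndex {ε : ℝ} (hε : 0 < ε) (z : Fin 2 → ℤ) :
    volume (cellIndex ε ⁻¹' {z}) = ENNReal.ofReal (ε ^ 2) := by
  have : cellIndex ε ⁻¹' {z} = (WithLp.ofLp : E2 → Fin 2 → ℝ) ⁻¹'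
      (Set.univ.pi fun i => Set.Ico (ε * z i) (ε * z i + ε)) := by
    ext p
    rw [mem_cellIndex]
    simp only [Set.mem_preimage, Set.mem_univ_pi, Set.mem_Ico]
    refine forall_congr' fun i => and_congr ?_ ?_
    · rw [sub_nonneg, le_div_iff₀ hε, mul_comm]
    · rw [sub_lt_iff_lt_add, div_lt_iff₀ hε]
      ring_nf
  rw [this, (PiLp.volume_preserving_ofLp (Fin 2)).measure_preimage
    (MeasurableSet.univ_pi fun i => measurableSet_Ico).nullMeasurableSet, Real.volume_pi_Ico]
  simp [← ENNReal.ofReal_mul hε.le, sq]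

theorem ae_linear_ne {c₀ c₁ : ℝ} (hc : c₀ ≠ 0 ∨ c₁ ≠ 0) (d : ℝ) :
    ∀ᵐ p : E2, c₀ * p 0 + c₁ * p 1 ≠ d := by
  let s : AffineSubspace ℝ E2 :=
    { carrier := {p | c₀ * p 0 + c₁ * p 1 = d}
      smul_vsub_vadd_mem' := by
        intro c p q r hp hq hr
        simp only [Set.mem_ofPred_eq, vsub_eq_sub, vadd_eq_add, PiLp.add_apply, PiLp.smul_apply,
          PiLp.sub_apply, smul_eq_mul] at *
        linear_combination c * hp - c * hq + hr }
  have hs : s ≠ ⊤ := by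
    intro h
    have hmem : ∀ f : Fin 2 → ℝ, c₀ * f 0 + c₁ * f 1 = d := fun f => by
      have : toV2 f ∈ s := h ▸ AffineSubspace.mem_top ℝ E2 _
      exact this
    have h1 := hmem ![0, 0]
    have h2 := hmem ![1, 0]
    have h3 := hmem ![0, 1]
    simp at h1 h2 h3
    rcases hc with hc | hc
    · exact hc (by linarith)
    · exact hc (by linarith)
  have := Measure.addHaar_affineSubspace volume s hs
  rw [ae_iff]
  simp only [ne_eq, not_not]
  exact this

theorem volume_meshTri_inter_add {ε : ℝ} (hε : 0 < ε) (x : Fin 2 → ℤ) (b : Bool) (B : Set E2) :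
    volume (meshTri ε x b ∩ B) + volume (meshTri ε x (!b) ∩ B) =
      volume (cellIndex ε ⁻¹' {x} ∩ B) := by
  wlog hb : b = false generalizing b
  · rw [add_comm]
    simpa [(by simpa using hb : b = true)] using this false rfl
  subst hb
  set H : Set E2 := {p | (p 0 / ε - x 0) + (p 1 / ε - x 1) ≤ 1} with hH
  have hHm : MeasurableSet H := measurableSet_le (by fun_prop) (by fun_prop)
  have g0 : ∀ᵐ p : E2, p 0 / ε - x 0 ≠ 1 := by
    filter_upwards [ae_linear_ne (c₀ := 1 / ε) (c₁ := 0) (Or.inl (by positivity)) (x 0 + 1)]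
      with p hp h
    exact hp (by linear_combination h)
  have g1 : ∀ᵐ p : E2, p 1 / ε - x 1 ≠ 1 := by
    filter_upwards [ae_linear_ne (c₀ := 0) (c₁ := 1 / ε) (Or.inr (by positivity)) (x 1 + 1)]
      with p hp h
    exact hp (by linear_combination h)
  have g2 : ∀ᵐ p : E2, (p 0 / ε - x 0) + (p 1 / ε - x 1) ≠ 1 := by
    filter_upwards [ae_linear_ne (c₀ := 1 / ε) (c₁ := 1 / ε) (Or.inl (by positivity))
      (x 0 + x 1 + 1)] with p hp h
    exact hp (by linear_combination h)
  have k1 : volume (meshTri ε x false ∩ B) = volume ((cellIndex ε ⁻¹' {x} ∩ B) ∩ H) := by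
    apply measure_congr
    filter_upwards [g0, g1] with p h0 h1
    refine propext ?_
    change (p ∈ meshTri ε x false ∧ p ∈ B) ↔ (p ∈ cellIndex ε ⁻¹' {x} ∧ p ∈ B) ∧ p ∈ H
    rw [mem_meshTri hε, mem_cellIndex, Fin.forall_fin_two, hH]
    simp only [Bool.false_eq_true, if_false, Set.mem_ofPred_eq]
    constructor
    · rintro ⟨⟨a1, a2, a3⟩, hB⟩
      exact ⟨⟨⟨⟨a1, lt_of_le_of_ne (by linarith) h0⟩, a2, lt_of_le_of_ne (by linarith) h1⟩, hB⟩, a3⟩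
    · rintro ⟨⟨⟨⟨a1, -⟩, a2, -⟩, hB⟩, a3⟩
      exact ⟨⟨a1, a2, a3⟩, hB⟩
  have k2 : volume (meshTri ε x true ∩ B) = volume ((cellIndex ε ⁻¹' {x} ∩ B) \ H) := by
    apply measure_congr
    filter_upwards [g0, g1, g2] with p h0 h1 h2
    refine propext ?_
    change (p ∈ meshTri ε x true ∧ p ∈ B) ↔ (p ∈ cellIndex ε ⁻¹' {x} ∧ p ∈ B) ∧ p ∉ H
    rw [mem_meshTri hε, mem_cellIndex, Fin.forall_fin_two, hH]
    simp only [if_true, Set.mem_ofPred_eq, not_le]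
    constructor
    · rintro ⟨⟨a1, a2, a3⟩, hB⟩
      exact ⟨⟨⟨⟨by linarith, lt_of_le_of_ne a1 h0⟩, by linarith, lt_of_le_of_ne a2 h1⟩, hB⟩,
        lt_of_le_of_ne a3 h2.symm⟩
    · rintro ⟨⟨⟨⟨-, a1⟩, -, a2⟩, hB⟩, a3⟩
      exact ⟨⟨a1.le, a2.le, a3.le⟩, hB⟩
  rw [Bool.not_false, k1, k2, measure_inter_add_sdiff _ hHm]

theorem volume_meshTri_toReal {ε : ℝ} (hε : 0 < ε) (x : Fin 2 → ℤ) (b : Bool) :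
    (volume (meshTri ε x b)).toReal = ε ^ 2 / 2 := by
  have h := volume_meshTri_inter_add hε x b Set.univ
  simp only [Set.inter_univ, volume_meshTri_not hε, volume_cellIndex hε] at h
  have hfin : volume (meshTri ε x b) ≠ ⊤ := fun htop => by simp [htop] at h
  have := congrArg ENNReal.toReal h
  rw [ENNReal.toReal_add hfin hfin, ENNReal.toReal_ofReal (by positivity)] at this
  linarith

theorem volume_cellIndex_inter_closedBall {ε : ℝ} (hε : 0 < ε) (x z : Fin 2 → ℤ) (q : E2) (ρ : ℝ) :
    volume (cellIndex ε ⁻¹' {x} ∩ Metric.closedBall (latpt ε z + q) ρ) =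
      volume (Metric.closedBall q ρ ∩ cellIndex ε ⁻¹' {x - z}) := by
  rw [← measure_preimage_add volume (latpt ε z)]
  congr 1
  ext p
  simp only [Set.mem_inter_iff, Set.mem_preimage (f := fun h => latpt ε z + h), mem_cellIndex,
    Metric.mem_closedBall, dist_add_left]
  rw [and_comm]
  refine and_congr Iff.rfl (forall_congr' fun i => ?_)
  have : (latpt ε z + p) i / ε - x i = p i / ε - (x - z) i := by
    simp; field_simp; ring
  rw [this]

/-- Shifts of the density functions of both triangles of a cell sum to one. -/
theorem sum_density_eq_one {ε : ℝ} (hε : 0 < ε) (x : Fin 2 → ℤ) (b : Bool) {χ χ' : E2 → ℝ}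
    (hχ : IsDensityFn (meshTri ε x b) χ) (hχ' : IsDensityFn (meshTri ε x !b) χ')
    (K : Fin 2 → ℤ) (q : E2) (hq : ∀ i, |q i| / ε + 1 ≤ K i) :
    ∑ z ∈ (Finset.Icc (-K) K).map (Equiv.subLeft x).toEmbedding,
      (χ (latpt ε z + q) + χ' (latpt ε z + q)) = 1 := by
  refine tendsto_nhds_unique_of_eventuallyEq (tendsto_finsetSum _ fun z _ =>
    (hχ (latpt ε z + q)).add (hχ' (latpt ε z + q))) tendsto_const_nhds ?_
  filter_upwards [Ioo_mem_nhdsGT hε] with ρ hρ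
  have hBpos : 0 < (volume (Metric.closedBall q ρ)).toReal :=
    ENNReal.toReal_pos (Metric.measure_closedBall_pos _ _ hρ.1).ne' measure_closedBall_lt_top.ne
  have hfin : ∀ (A : Set E2) (p : E2), volume (A ∩ Metric.closedBall p ρ) ≠ ⊤ := fun A p =>
    ((measure_mono Set.inter_subset_right).trans_lt measure_closedBall_lt_top).ne
  have hterm : ∀ z : Fin 2 → ℤ,
      (volume (meshTri ε x b ∩ Metric.closedBall (latpt ε z + q) ρ)).toReal /
          (volume (Metric.closedBall (latpt ε z + q) ρ)).toReal +
        (volume (meshTri ε x (!b) ∩ Metric.closedBall (latpt ε z + q) ρ)).toReal /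
          (volume (Metric.closedBall (latpt ε z + q) ρ)).toReal =
      (volume.restrict (Metric.closedBall q ρ) (cellIndex ε ⁻¹' {x - z})).toReal /
        (volume (Metric.closedBall q ρ)).toReal := by
    intro z
    rw [← add_div, ← ENNReal.toReal_add (hfin _ _) (hfin _ _), volume_meshTri_inter_add hε,
      volume_cellIndex_inter_closedBall hε, Measure.addHaar_closedBall_center,
      Measure.addHaar_closedBall_center volume q,
      Measure.restrict_apply (measurableSet_cellIndex ε _), Set.inter_comm]
  simp only [hterm]
  rw [Finset.sum_map, ← Finset.sum_div]
  simp only [Equiv.coe_toEmbedding, Equiv.subLeft_apply, sub_sub_cancel]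
  rw [← ENNReal.toReal_sum (fun z _ => ?_),
    sum_measure_preimage_singleton _ (fun z _ => measurableSet_cellIndex ε z),
    Measure.restrict_apply ((measurable_cellIndex ε) (Finset.measurableSet _)),
    Set.inter_eq_right.2, div_self hBpos.ne']
  · intro p hp
    have hi : ∀ i, |p i - q i| ≤ ε := fun i => by
      have := (PiLp.norm_apply_le (p - q) i).trans
        ((mem_closedBall_iff_norm.1 hp).trans hρ.2.le)
      simpa using this
    have hpi : ∀ i, |p i / ε| ≤ K i := fun i => by
      refine le_trans ?_ (hq i)
      rw [abs_div, abs_of_pos hε, div_add_one hε.ne']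
      gcongr
      have := abs_sub_abs_le_abs_sub (p i) (q i)
      linarith [hi i]
    simp only [Set.mem_preimage, Finset.coe_Icc, Set.mem_Icc, Pi.le_def, cellIndex, Pi.neg_apply]
    refine ⟨fun i => ?_, fun i => ?_⟩
    · rw [Int.le_floor]
      push_cast
      exact (abs_le.1 (hpi i)).1
    · have : (⌊p i / ε⌋ : ℝ) ≤ K i := (Int.floor_le _).trans (abs_le.1 (hpi i)).2
      exact_mod_cast this
  · rw [Measure.restrict_apply (measurableSet_cellIndex ε _)]
    exact hfin _ _

theorem bondInt_nonneg {T : Set E2} {χ : E2 → ℝ} (hχ : IsDensityFn T χ) (ε : ℝ)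
    (z r : Fin 2 → ℤ) : 0 ≤ bondInt ε χ z r :=
  intervalIntegral.integral_nonneg zero_le_one fun _ _ => hχ.nonneg _

theorem exists_mem_of_bondInt_ne_zero {T : Set E2} {χ : E2 → ℝ} (hχ : IsDensityFn T χ)
    (hT : IsClosed T) {ε : ℝ} {z r : Fin 2 → ℤ} (h : bondInt ε χ z r ≠ 0) :
    ∃ t ∈ Set.Icc (0 : ℝ) 1, latpt ε z + t • (ε • zvec r) ∈ T := by
  by_contra! hcon
  refine h ?_
  have : bondInt ε χ z r = ∫ _t in (0 : ℝ)..1, (0 : ℝ) :=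
    intervalIntegral.integral_congr fun t ht => by
      rw [Set.uIcc_of_le zero_le_one] at ht
      exact hχ.eq_zero hT (hcon t ht)
  simpa using this

theorem bondInt_reflect {ε : ℝ} (χ : E2 → ℝ) (x z r : Fin 2 → ℤ) :
    bondInt ε (fun p => χ ((latpt ε x + latpt ε (x + eint 0 + eint 1)) - p)) z r =
      bondInt ε χ (x + x + eint 0 + eint 1 - r - z) r := by
  have h := intervalIntegral.integral_comp_sub_left (a := 0) (b := 1)
    (fun t : ℝ => χ (latpt ε (x + x + eint 0 + eint 1 - r - z) + t • (ε • zvec r))) 1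
  rw [sub_self, sub_zero] at h
  rw [bondInt, bondInt, ← h]
  congr 1
  ext t
  congr 1
  ext i
  simp
  ring

/-- The lattice sites whose `r`-bond can meet a triangle of the cell at `x`. -/
def bondSites (x r : Fin 2 → ℤ) : Finset (Fin 2 → ℤ) :=
  (Finset.Icc (-fun i => |r i| + 1) (fun i => |r i| + 1)).map (Equiv.subLeft x).toEmbedding

theorem mem_bondSites {x r z : Fin 2 → ℤ} :
    z ∈ bondSites x r ↔ ∀ i, |x i - z i| ≤ |r i| + 1 := by
  simp only [bondSites, Finset.mem_map_equiv, Equiv.subLeft_symm_apply, Finset.mem_Icc, Pi.le_def,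
    Pi.neg_apply, Pi.add_apply, abs_le, ← forall_and]
  exact forall_congr' fun i => by constructor <;> rintro ⟨h1, h2⟩ <;> constructor <;> linarith

theorem mem_bondSites_of_mem_meshTri {ε : ℝ} (hε : 0 < ε) {x r z : Fin 2 → ℤ} {b : Bool} {t : ℝ}
    (ht : t ∈ Set.Icc (0 : ℝ) 1) (h : latpt ε z + t • (ε • zvec r) ∈ meshTri ε x b) :
    z ∈ bondSites x r := by
  rw [mem_bondSites]
  intro i
  have h1 := meshTri_subset_closedCell hε x b h i
  have e : (latpt ε z + t • (ε • zvec r)) i / ε = z i + t * r i := by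
    simp; field_simp
  rw [e] at h1
  have h2 : |t * (r i : ℝ)| ≤ |(r i : ℝ)| := by
    rw [abs_mul, abs_of_nonneg ht.1]
    exact mul_le_of_le_one_left (abs_nonneg _) ht.2
  have h3 : |(x i : ℝ) - z i| ≤ |(r i : ℝ)| + 1 := by
    rw [abs_le] at h2 ⊢
    constructor <;> linarith
  exact_mod_cast h3

theorem bondInt_eq_zero_of_notMem {ε : ℝ} (hε : 0 < ε) {x r z : Fin 2 → ℤ} {b : Bool} {χ : E2 → ℝ}
    (hχ : IsDensityFn (meshTri ε x b) χ) (hz : z ∉ bondSites x r) : bondInt ε χ z r = 0 := by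
  by_contra h
  obtain ⟨t, ht, hmem⟩ := exists_mem_of_bondInt_ne_zero hχ (isClosed_meshTri x b) h
  exact hz (mem_bondSites_of_mem_meshTri hε ht hmem)

/-- Bond density lemma: the bonds in direction `r` see half of each cell in each triangle. -/
theorem sum_bondInt {ε : ℝ} (hε : 0 < ε) (x r : Fin 2 → ℤ) (b : Bool) {χ : E2 → ℝ}
    (hχ : IsDensityFn (meshTri ε x b) χ) :
    ∑ z ∈ bondSites x r, bondInt ε χ z r = 1 / 2 := by
  set χ' : E2 → ℝ := fun p => χ ((latpt ε x + latpt ε (x + eint 0 + eint 1)) - p) with hχ'_def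
  have hχ' : IsDensityFn (meshTri ε x !b) χ' := by
    rw [← meshTri_reflect hε]
    exact hχ.reflect _
  have hsymm : ∑ z ∈ bondSites x r, bondInt ε χ' z r = ∑ z ∈ bondSites x r, bondInt ε χ z r := by
    rw [← tsum_eq_sum (L := .unconditional _) (fun z hz => bondInt_eq_zero_of_notMem hε hχ hz),
      ← tsum_eq_sum (L := .unconditional _) (fun z hz => bondInt_eq_zero_of_notMem hε hχ' hz),
      ← Equiv.tsum_eq (Equiv.subLeft (x + x + eint 0 + eint 1 - r)) (fun z => bondInt ε χ z r)]
    exact tsum_congr fun z => bondInt_reflect χ x z r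
  have hm : MeasurableSet (meshTri ε x b) := (isClosed_meshTri x b).measurableSet
  have hm' : MeasurableSet (meshTri ε x !b) := (isClosed_meshTri x _).measurableSet
  have hone : ∑ z ∈ bondSites x r, (bondInt ε χ z r + bondInt ε χ' z r) = 1 := by
    have e : ∀ z, bondInt ε χ z r + bondInt ε χ' z r = ∫ t in (0 : ℝ)..1,
        (χ (latpt ε z + t • (ε • zvec r)) + χ' (latpt ε z + t • (ε • zvec r))) := fun z =>
      (intervalIntegral.integral_add (hχ.intervalIntegrable hm _ _)
        (hχ'.intervalIntegrable hm' _ _)).symm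
    simp only [e]
    rw [← intervalIntegral.integral_finsetSum fun z _ =>
      (hχ.intervalIntegrable hm _ _).add (hχ'.intervalIntegrable hm' _ _)]
    have : ∫ _t in (0 : ℝ)..1, (1 : ℝ) = 1 := by simp
    refine (intervalIntegral.integral_congr fun t ht => ?_).trans this
    rw [Set.uIcc_of_le zero_le_one] at ht
    refine sum_density_eq_one hε x b hχ hχ' _ _ fun i => ?_
    have : |(t • (ε • zvec r)) i| / ε = t * |(r i : ℝ)| := by
      simp [abs_mul, abs_of_pos hε, abs_of_nonneg ht.1]
      field_simp
    rw [this]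
    push_cast
    have := mul_le_of_le_one_left (abs_nonneg (r i : ℝ)) ht.2
    linarith
  rw [Finset.sum_add_distrib, hsymm] at hone
  linarith

theorem outer_sub (a a' : E2) (r : Fin 2 → ℤ) : outer (a - a') r = outer a r - outer a' r := by
  ext i j; simp [outer]; ring

theorem Sa_sub_pW {ε : ℝ} (hε : 0 < ε) (R : Finset (Fin 2 → ℤ)) (DV : (R → E2) → R → E2)
    (y : (Fin 2 → ℤ) → E2) (x : Fin 2 → ℤ) (b : Bool) {χ : E2 → ℝ}
    (hχ : IsDensityFn (meshTri ε x b) χ) (F : Mat2) :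
    Sa ε R DV y (volume (meshTri ε x b)).toReal χ - pW R DV F =
      ∑ r : R, ∑ z ∈ bondSites x r, (2 * bondInt ε χ z r) •
        outer (DV (fun s => fd2 ε s y z) r - DV (stencil R F) r) r := by
  have harea : ε ^ 2 / (volume (meshTri ε x b)).toReal = 2 := by
    rw [volume_meshTri_toReal hε]; field_simp
  rw [Sa, pW, harea, ← Finset.sum_sub_distrib]
  refine Finset.sum_congr rfl fun r _ => ?_
  rw [tsum_eq_sum (s := bondSites x r)
    (fun z hz => by rw [bondInt_eq_zero_of_notMem hε hχ hz, zero_smul])]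
  simp only [outer_sub, smul_sub, Finset.sum_sub_distrib]
  rw [← Finset.sum_smul, ← Finset.mul_sum, sum_bondInt hε x r b hχ, Finset.smul_sum]
  norm_num [mul_smul]

theorem frobNorm_Sa_sub_pW_le {N : ℕ} (hN : 1 ≤ N) {ε : ℝ} (hε : 0 < ε)
    (R : Finset (Fin 2 → ℤ)) (DV : (R → E2) → R → E2) (M : R → R → ℝ) (hM : ∀ r s, 0 ≤ M r s)
    (hLip : ∀ (g h : R → E2) (r : R), ‖DV g r - DV h r‖ ≤ ∑ s : R, M r s * ‖g s - h s‖)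
    {y : (Fin 2 → ℤ) → E2} (hy : InY N y) (x : Fin 2 → ℤ) (b : Bool) {χ : E2 → ℝ}
    (hχ : IsDensityFn (meshTri ε x b) χ) :
    frobNorm (Sa ε R DV y (volume (meshTri ε x b)).toReal χ - pW R DV (meshGrad ε y x b)) ≤
      ε * (∑ r : R, ∑ s : R, ‖zvec r‖ * ‖zvec s‖ * M r s) *
        osc ε (gradFn ε y) (omegaA ε R (meshTri ε x b)) := by
  set L := ε * osc ε (gradFn ε y) (omegaA ε R (meshTri ε x b)) with hL
  set F := meshGrad ε y x b
  rw [Sa_sub_pW hε R DV y x b hχ F]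
  have hterm : ∀ r : R, ∀ z : Fin 2 → ℤ,
      frobNorm ((2 * bondInt ε χ z r) •
        outer (DV (fun s => fd2 ε s y z) r - DV (stencil R F) r) r) ≤
      2 * bondInt ε χ z r * (L * ∑ s : R, ‖zvec r‖ * ‖zvec s‖ * M r s) := by
    intro r z
    have h0 := bondInt_nonneg hχ ε z r
    rw [frobNorm_smul (by positivity), frobNorm_outer]
    rcases h0.eq_or_lt with h | h
    · simp [← h]
    refine mul_le_mul_of_nonneg_left ?_ (by positivity)
    obtain ⟨t, ht, hmem⟩ := exists_mem_of_bondInt_ne_zero hχ (isClosed_meshTri x b) h.ne'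
    calc _ ≤ (∑ s : R, M r s * (L * ‖zvec s‖)) * ‖zvec r‖ := by
          refine mul_le_mul_of_nonneg_right ((hLip _ _ r).trans ?_) (norm_nonneg _)
          exact Finset.sum_le_sum fun s _ => mul_le_mul_of_nonneg_left
            (norm_fd2_sub_stencil_le hN hε R hy x b r s z ht hmem) (hM r s)
      _ = _ := by
          rw [Finset.sum_mul, Finset.mul_sum]
          exact Finset.sum_congr rfl fun s _ => by ring
  calc _ ≤ ∑ r : R, ∑ z ∈ bondSites x r,
        2 * bondInt ε χ z r * (L * ∑ s : R, ‖zvec r‖ * ‖zvec s‖ * M r s) :=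
        (frobNorm_sum_le _ _).trans (Finset.sum_le_sum fun r _ =>
          (frobNorm_sum_le _ _).trans (Finset.sum_le_sum fun z _ => hterm r z))
    _ = ∑ r : R, L * ∑ s : R, ‖zvec r‖ * ‖zvec s‖ * M r s := by
        refine Finset.sum_congr rfl fun r _ => ?_
        rw [← Finset.sum_mul, ← Finset.mul_sum, sum_bondInt hε x r b hχ]
        ring
    _ = _ := by
        rw [← Finset.mul_sum, hL]
        ring

/-- Lipschitz estimate for the atomistic stress:
`|Σ_a(y;T) − ∂W(∇y(T))| ≤ ε M^a osc(∇y; ω_T^a)` for every `y ∈ 𝓨` and every triangle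
`T` of `𝒯_ε^per` (`b = false`: lower triangle, `b = true`: upper triangle at `x`). -/
theorem stmt_13 (N : ℕ) (hN : 1 ≤ N)
    (R : Finset (Fin 2 → ℤ)) (hR : (0 : Fin 2 → ℤ) ∉ R)
    (V : (R → EuclideanSpace ℝ (Fin 2)) → ℝ) (hV : ContDiff ℝ 1 V)
    (DV : (R → EuclideanSpace ℝ (Fin 2)) → R → EuclideanSpace ℝ (Fin 2))
    (hDV : ∀ (g : R → EuclideanSpace ℝ (Fin 2)) (r : R) (a : EuclideanSpace ℝ (Fin 2)),
      ⟪DV g r, a⟫ = fderiv ℝ V g (Pi.single r a))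
    (M : R → R → ℝ) (hM : ∀ r s, 0 ≤ M r s)
    (hLip : ∀ (g h : R → EuclideanSpace ℝ (Fin 2)) (r : R),
      ‖DV g r - DV h r‖ ≤ ∑ s : R, M r s * ‖g s - h s‖)
    (y : (Fin 2 → ℤ) → EuclideanSpace ℝ (Fin 2)) (hy : InY N y)
    (x : Fin 2 → ℤ) (b : Bool)
    (χ : EuclideanSpace ℝ (Fin 2) → ℝ)
    (hχ : IsDensityFn
      (if b then Tup (1 / (N : ℝ)) x else Tlo (1 / (N : ℝ)) x) χ) :
    frobNorm
        (Sa (1 / (N : ℝ)) R DV y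
            (volume (if b then Tup (1 / (N : ℝ)) x else Tlo (1 / (N : ℝ)) x)).toReal χ
          - pW R DV (if b then gradUp (1 / (N : ℝ)) y x else gradLo (1 / (N : ℝ)) y x))
      ≤ (1 / (N : ℝ)) * (∑ r : R, ∑ s : R, ‖zvec (↑r)‖ * ‖zvec (↑s)‖ * M r s)
          * osc (1 / (N : ℝ)) (gradFn (1 / (N : ℝ)) y)
              (omegaA (1 / (N : ℝ)) R
                (if b then Tup (1 / (N : ℝ)) x else Tlo (1 / (N : ℝ)) x)) := by
  exact frobNorm_Sa_sub_pW_le hN (by positivity) R DV M hM hLip hy x b hχ
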